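/- Let a finite HMM on hidden space H and observation space O satisfy the low-rank transition assumption with rank d, with factorization P(h'|h) = w*(h')ᵀψ*(h), and let m ≥ 1. Then for every k ≥ 2 and every observation history o_{1:k−1} with P(o_{1:k−1}) > 0, the conditional joint distribution of the next m+1 observations factorizes as P(o_{k:k+m} | o_{1:k−1}) = ( Σ_{h∈H} M(o_{k:k+m}|h) w*(h) )ᵀ ( Σ_{h'∈H} ψ*(h') b(o_{1:k−1})(h') ), where M(o_{k:k+m}|h) is the probability of observing o_k,…,o_{k+m} given h_k = h, and b(o_{1:k−1}) is the belief state (posterior of h_{k−1} given o_{1:k−1}). -/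

import Mathlib

/-!
STATEMENT 5: Low-rank factorization of the conditional joint distribution of
the next m+1 observations:
`P(o_{k:k+m} | o_{1:k−1}) = (Σ_h M(o_{k:k+m}|h) w*(h))ᵀ (Σ_h' ψ*(h') b(o_{1:k−1})(h'))`.
-/

open Finset

/-- A probability distribution on a finite type. -/
def IsDist {S : Type*} [Fintype S] (f : S → ℝ) : Prop :=
  (∀ x, 0 ≤ f x) ∧ ∑ x, f x = 1

/-- Joint probability of a hidden path and an observation sequence. -/
noncomputable def hmmJoint {H O : Type*} [Fintype H]
    (ν : H → ℝ) (P : H → H → ℝ) (T : H → O → ℝ)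
    {k : ℕ} (hp : Fin k → H) (o : Fin k → O) : ℝ :=
  ∏ s : Fin k,
    (T (hp s) (o s) *
      (if (s : ℕ) = 0 then ν (hp s)
       else P (hp ⟨(s : ℕ) - 1, by have := s.isLt; omega⟩) (hp s)))

/-- Marginal probability of an observation sequence. -/
noncomputable def hmmObs {H O : Type*} [Fintype H]
    (ν : H → ℝ) (P : H → H → ℝ) (T : H → O → ℝ)
    {k : ℕ} (o : Fin k → O) : ℝ :=
  ∑ hp : Fin k → H, hmmJoint ν P T hp o

/-- Conditional joint probability of the next `m+1` observations given the
observation history. -/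
noncomputable def hmmCondNextM {H O : Type*} [Fintype H]
    (ν : H → ℝ) (P : H → H → ℝ) (T : H → O → ℝ)
    {k m : ℕ} (o : Fin k → O) (wseq : Fin (m + 1) → O) : ℝ :=
  hmmObs ν P T (Fin.append o wseq) / hmmObs ν P T o

/-- The m-step emission probability `M(o_{k:k+m} | h)`. -/
noncomputable def hmmMEmission {H O : Type*} [Fintype H] [DecidableEq H]
    (P : H → H → ℝ) (T : H → O → ℝ)
    {m : ℕ} (wseq : Fin (m + 1) → O) (h : H) : ℝ :=
  ∑ hp : Fin (m + 1) → H,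
    (if hp 0 = h then (1 : ℝ) else 0) *
      ∏ s : Fin (m + 1),
        (T (hp s) (wseq s) *
          (if (s : ℕ) = 0 then (1 : ℝ)
           else P (hp ⟨(s : ℕ) - 1, by have := s.isLt; omega⟩) (hp s)))

/-- The belief state `b(o_{1:k})(h) = P(h_k = h | o_{1:k})`. -/
noncomputable def hmmBelief {H O : Type*} [Fintype H] [DecidableEq H]
    (ν : H → ℝ) (P : H → H → ℝ) (T : H → O → ℝ)
    {k : ℕ} (hk : 0 < k) (o : Fin k → O) (h : H) : ℝ :=
  (∑ hp : Fin k → H,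
      if hp ⟨k - 1, Nat.sub_lt hk one_pos⟩ = h then hmmJoint ν P T hp o else 0) /
    hmmObs ν P T o

/-- The weight of a hidden path together with its emissions, leaving out the initial state. -/
noncomputable def hmmPathWeight {H O : Type*} (P : H → H → ℝ) (T : H → O → ℝ)
    {m : ℕ} (wseq : Fin (m + 1) → O) (q : Fin (m + 1) → H) : ℝ :=
  ∏ s : Fin (m + 1),
    (T (q s) (wseq s) *
      (if (s : ℕ) = 0 then (1 : ℝ)
       else P (q ⟨(s : ℕ) - 1, by have := s.isLt; omega⟩) (q s)))

theorem hmmJoint_append {H O : Type*} [Fintype H]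
    (ν : H → ℝ) (P : H → H → ℝ) (T : H → O → ℝ)
    {K m : ℕ} (hK : 0 < K) (o : Fin K → O) (wseq : Fin (m + 1) → O)
    (p : Fin K → H) (q : Fin (m + 1) → H) :
    hmmJoint ν P T (Fin.append p q) (Fin.append o wseq) =
      hmmJoint ν P T p o * P (p ⟨K - 1, Nat.sub_lt hK one_pos⟩) (q 0) *
        hmmPathWeight P T wseq q := by
  have hleft : ∀ s (hs : s < K) (hs' : s < K + (m + 1)),
      Fin.append p q ⟨s, hs'⟩ = p ⟨s, hs⟩ := fun s hs _ =>
    Fin.append_left p q ⟨s, hs⟩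
  have hright : ∀ s (hs : s < m + 1) (hs' : K + s < K + (m + 1)),
      Fin.append p q ⟨K + s, hs'⟩ = q ⟨s, hs⟩ := fun s hs _ =>
    Fin.append_right p q ⟨s, hs⟩
  unfold hmmJoint hmmPathWeight
  rw [Fin.prod_univ_add, mul_assoc]
  congr 1
  · refine Finset.prod_congr rfl fun s _ => ?_
    simp only [Fin.append_left, Fin.val_castAdd]
    rw [hleft _ (by omega)]
  · rw [Fin.prod_univ_succ, Fin.prod_univ_succ]
    have hprev : Fin.append p q ⟨K + ((0 : Fin (m + 1)) : ℕ) - 1, by simp; omega⟩ =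
        p ⟨K - 1, Nat.sub_lt hK one_pos⟩ := hleft (K - 1) (by omega) (by omega)
    have hsucc : ∀ s : Fin m,
        Fin.append p q ⟨K + (s.succ : ℕ) - 1, by have := s.succ.isLt; omega⟩ =
          q s.castSucc := fun s =>
      hright s (by omega) (by omega)
    have hzero : K + ((0 : Fin (m + 1)) : ℕ) ≠ 0 := by simp; omega
    have hne : ∀ s : Fin m, K + (s.succ : ℕ) ≠ 0 := fun s => by simp
    simp only [Fin.append_right, Fin.val_natAdd, if_neg hzero, hprev, hne, hsucc, if_false]
    simp only [Fin.val_succ, Nat.succ_ne_zero, Fin.val_zero, if_true, if_false, mul_one]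
    rw [mul_comm (T _ _), mul_assoc]
    rfl

theorem hmmObs_append {H O : Type*} [Fintype H]
    (ν : H → ℝ) (P : H → H → ℝ) (T : H → O → ℝ)
    {K m : ℕ} (hK : 0 < K) (o : Fin K → O) (wseq : Fin (m + 1) → O) :
    hmmObs ν P T (Fin.append o wseq) =
      ∑ p : Fin K → H, ∑ q : Fin (m + 1) → H,
        hmmJoint ν P T p o * P (p ⟨K - 1, Nat.sub_lt hK one_pos⟩) (q 0) *
          hmmPathWeight P T wseq q := by
  unfold hmmObs
  rw [← (Fin.appendEquiv K (m + 1)).sum_comp, Fintype.sum_prod_type]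
  exact Finset.sum_congr rfl fun p _ => Finset.sum_congr rfl fun q _ =>
    hmmJoint_append ν P T hK o wseq p q

theorem sum_hmmMEmission_mul {H O : Type*} [Fintype H] [DecidableEq H]
    (P : H → H → ℝ) (T : H → O → ℝ)
    {m : ℕ} (wseq : Fin (m + 1) → O) (f : H → ℝ) :
    ∑ h, hmmMEmission P T wseq h * f h = ∑ q, hmmPathWeight P T wseq q * f (q 0) := by
  simp only [hmmMEmission, Finset.sum_mul]
  rw [Finset.sum_comm]
  refine Finset.sum_congr rfl fun q _ => ?_
  simp [hmmPathWeight]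

theorem sum_mul_hmmBelief {H O : Type*} [Fintype H] [DecidableEq H]
    (ν : H → ℝ) (P : H → H → ℝ) (T : H → O → ℝ)
    {k : ℕ} (hk : 0 < k) (o : Fin k → O) (f : H → ℝ) :
    ∑ h, f h * hmmBelief ν P T hk o h =
      (∑ p, f (p ⟨k - 1, Nat.sub_lt hk one_pos⟩) * hmmJoint ν P T p o) /
        hmmObs ν P T o := by
  simp only [hmmBelief, mul_div_assoc', ← Finset.sum_div, Finset.mul_sum]
  rw [Finset.sum_comm]
  simp

theorem multi_step_low_rank_factorization
    {H O : Type*} [Fintype H] [DecidableEq H] [Fintype O]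
    (ν : H → ℝ) (P : H → H → ℝ) (T : H → O → ℝ)
    (hν : IsDist ν) (hP : ∀ h, IsDist (P h)) (hT : ∀ h, IsDist (T h))
    -- low-rank transition structure of rank d
    (d : ℕ) (w ψ : H → Fin d → ℝ)
    (hlow : ∀ h h', P h h' = ∑ i, w h' i * ψ h i)
    (m : ℕ) (hm : 1 ≤ m)
    -- an observation history of length K = k−1 ≥ 1 with positive probability
    (K : ℕ) (hK : 0 < K) (o : Fin K → O) (hpos : 0 < hmmObs ν P T o)
    (wseq : Fin (m + 1) → O) :
    hmmCondNextM ν P T o wseq =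
      ∑ i : Fin d,
        (∑ h : H, hmmMEmission P T wseq h * w h i) *
          (∑ h' : H, ψ h' i * hmmBelief ν P T hK o h') := by
  simp only [hmmCondNextM, sum_hmmMEmission_mul P T wseq (fun h => w h _),
    sum_mul_hmmBelief ν P T hK o (fun h => ψ h _), mul_div_assoc', ← Finset.sum_div]
  rw [hmmObs_append ν P T hK]
  congr 1
  simp only [hlow, Finset.mul_sum, Finset.sum_mul]
  conv_rhs => rw [Finset.sum_comm]
  refine Finset.sum_congr rfl fun p _ => ?_
  conv_rhs => rw [Finset.sum_comm]
  exact Finset.sum_congr rfl fun q _ => Finset.sum_congr rfl fun i _ => by ring
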